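/- arXiv:2302.09666 — 2 statements merged into one kernel-verified Lean document; each statement's English description precedes it below -/
import Mathlib

section
/- Let FS and FS′ be filesystems. Then the command set A = { ⟨n, FS(n), FS′(n)⟩ : n a node with FS(n) ≠ FS′(n) } is canonical, and applying A to FS yields FS′, i.e., A FS = FS′. -/
namespace FileSync

/-- A filesystem value: a directory, the empty value, or a file with content from `C`. -/
inductive Val (C : Type) : Type where
  | dir : Val C
  | empty : Val C
  | file : C → Val C

/-- The type of a value, ordered E < F < D via 0 < 1 < 2. -/
def vtype {C : Type} : Val C → ℕ
  | Val.empty => 0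
  | Val.file _ => 1
  | Val.dir => 2

/-- A node is a nonempty finite sequence of names. -/
abbrev Node (N : Type) : Type := { l : List N // l ≠ ([] : List N) }

/-- `Anc m n`: `m` is a proper ancestor of (strictly above) `n`. -/
def Anc {N : Type} (m n : Node N) : Prop := m.1 <+: n.1 ∧ m ≠ n

/-- Two nodes are comparable if one is a prefix of the other. -/
def NodesComparable {N : Type} (m n : Node N) : Prop := m.1 <+: n.1 ∨ n.1 <+: m.1

/-- `IsParent p n`: `p` is the parent of `n` (removing the last name of `n` gives `p`). -/
def IsParent {N : Type} (p n : Node N) : Prop := ∃ a : N, n.1 = p.1 ++ [a]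

/-- A command: a node, an input value (precondition) and an output value. -/
structure Cmd (N C : Type) where
  node : Node N
  inp : Val C
  out : Val C

variable {N C : Type} [DecidableEq N]

/-- A valid filesystem: finitely many non-empty nodes, and the tree property. -/
def ValidFS (f : Node N → Val C) : Prop :=
  {n : Node N | f n ≠ Val.empty}.Finite ∧
  ∀ n m : Node N, Anc m n → f n ≠ Val.empty → f m = Val.dir

/-- Replace the value at the node of `σ` by its output value. -/
def upd (f : Node N → Val C) (σ : Cmd N C) : Node N → Val C :=
  fun m => if m = σ.node then σ.out else f m

/-- `SeqOK α f`: the command sequence `α` does not break the filesystem `f`: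
each command finds its input value and yields a valid filesystem. -/
def SeqOK : List (Cmd N C) → (Node N → Val C) → Prop
  | [], _ => True
  | σ :: rest, f => f σ.node = σ.inp ∧ ValidFS (upd f σ) ∧ SeqOK rest (upd f σ)

/-- The result of applying a command sequence (left to right). -/
def applySeq : List (Cmd N C) → (Node N → Val C) → (Node N → Val C)
  | [], f => f
  | σ :: rest, f => applySeq rest (upd f σ)

/-- A sequence is non-breaking if there is at least one filesystem it does not break. -/
def NonBreaking (α : List (Cmd N C)) : Prop := ∃ f, ValidFS f ∧ SeqOK α f

/-- Semantic equivalence: on every filesystem both break, or both yield the same result. -/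
def SeqEquiv (α β : List (Cmd N C)) : Prop :=
  ∀ f, ValidFS f → ((SeqOK α f ↔ SeqOK β f) ∧ (SeqOK α f → applySeq α f = applySeq β f))

/-- `SeqExt α β`: `β` semantically extends `α` (`α ≤ β`). -/
def SeqExt (α β : List (Cmd N C)) : Prop :=
  ∀ f, ValidFS f → SeqOK α f → SeqOK β f ∧ applySeq β f = applySeq α f

/-- The `≪` relation between commands on child–parent or parent–child nodes. -/
def LL (σ τ : Cmd N C) : Prop :=
  (IsParent τ.node σ.node ∧ σ.out = Val.empty ∧ σ.inp ≠ Val.empty ∧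
      τ.inp = Val.dir ∧ τ.out ≠ Val.dir) ∨
  (IsParent σ.node τ.node ∧ σ.out = Val.dir ∧ σ.inp ≠ Val.dir ∧
      τ.inp = Val.empty ∧ τ.out ≠ Val.empty)

/-- A canonical command set: finite, no null commands, at most one command per node,
`≪`-connected (commands on distinct comparable nodes are joined by a `≪`-chain in the set). -/
def Canonical (A : Set (Cmd N C)) : Prop :=
  A.Finite ∧
  (∀ σ ∈ A, σ.inp ≠ σ.out) ∧
  (∀ σ ∈ A, ∀ τ ∈ A, σ.node = τ.node → σ = τ) ∧
  (∀ σ ∈ A, ∀ τ ∈ A, σ.node ≠ τ.node → NodesComparable σ.node τ.node →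
    Relation.ReflTransGen (fun a b => a ∈ A ∧ b ∈ A ∧ LL a b) σ τ ∨
    Relation.ReflTransGen (fun a b => a ∈ A ∧ b ∈ A ∧ LL a b) τ σ)

/-- A sequence honors `≪`: whenever `σ ≪ τ` for members, `σ` precedes `τ`. -/
def Honors (α : List (Cmd N C)) : Prop :=
  ∀ σ ∈ α, ∀ τ ∈ α, LL σ τ → List.Sublist [σ, τ] α

/-- A canonical sequence: its commands form a canonical set and it honors `≪`. -/
def CanonicalSeq (α : List (Cmd N C)) : Prop :=
  α.Nodup ∧ Canonical {σ : Cmd N C | σ ∈ α} ∧ Honors α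

/-- `Orders A α`: the sequence `α` is an arrangement of the set `A` honoring `≪`. -/
def Orders (A : Set (Cmd N C)) (α : List (Cmd N C)) : Prop :=
  α.Nodup ∧ (∀ σ : Cmd N C, σ ∈ α ↔ σ ∈ A) ∧ Honors α

/-- The action of a canonical set: `A` does not break `f`
(some `≪`-honoring arrangement exists, and every such arrangement works on `f`). -/
def SetNoBreak (A : Set (Cmd N C)) (f : Node N → Val C) : Prop :=
  (∃ α, Orders A α) ∧ ∀ α, Orders A α → SeqOK α f

/-- `SetApp A f g`: applying the set `A` (in any `≪`-honoring order) to `f` yields `g`. -/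
def SetApp (A : Set (Cmd N C)) (f g : Node N → Val C) : Prop :=
  SetNoBreak A f ∧ ∀ α, Orders A α → applySeq α f = g

/-- The set `S` has a command on node `n`. -/
def Mentions (S : Set (Cmd N C)) (n : Node N) : Prop := ∃ ρ ∈ S, ρ.node = n

/-- Two canonical sets are refluent if some filesystem is broken by neither. -/
def Refluent (A B : Set (Cmd N C)) : Prop :=
  ∃ f, ValidFS f ∧ SetNoBreak A f ∧ SetNoBreak B f

/-- Canonical sets are jointly refluent if a single filesystem is broken by none of them. -/
def JointlyRefluent {k : ℕ} (A : Fin k → Set (Cmd N C)) : Prop :=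
  ∃ f, ValidFS f ∧ ∀ i, SetNoBreak (A i) f

/-- Two distinct commands are in conflict if they are on the same node, or one is on a
proper ancestor node, creates a non-directory, and the lower one creates non-empty content. -/
def Conflict (σ τ : Cmd N C) : Prop :=
  σ ≠ τ ∧ (σ.node = τ.node ∨
    (Anc σ.node τ.node ∧ σ.out ≠ Val.dir ∧ τ.out ≠ Val.empty) ∨
    (Anc τ.node σ.node ∧ τ.out ≠ Val.dir ∧ σ.out ≠ Val.empty))

/-- A merger: a maximal canonical subset of `⋃ i, A i`. -/
def Merger {k : ℕ} (A : Fin k → Set (Cmd N C)) (M : Set (Cmd N C)) : Prop :=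
  M ⊆ (⋃ i, A i) ∧ Canonical M ∧
  ∀ M' : Set (Cmd N C), M ⊆ M' → M' ⊆ (⋃ i, A i) → Canonical M' → M' = M

/-- `B` is an initial segment of `A`: there is an `≪`-honoring arrangement of `A` in which
all commands of `B` precede all commands of `A \ B`. -/
def InitSeg (B A : Set (Cmd N C)) : Prop :=
  B ⊆ A ∧ ∃ α₁ α₂ : List (Cmd N C), Orders B α₁ ∧ Orders (A \ B) α₂ ∧ Orders A (α₁ ++ α₂)

/-- The inverse of a command. -/
def cinv (σ : Cmd N C) : Cmd N C := ⟨σ.node, σ.out, σ.inp⟩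

/-- The inverse of a sequence: inverses of its commands in reverse order. -/
def seqInv (α : List (Cmd N C)) : List (Cmd N C) := (α.map cinv).reverse

/-- The difference set. -/
def DA (f g : Node N → Val C) : Set (Cmd N C) :=
  {σ : Cmd N C | σ.inp = f σ.node ∧ σ.out = g σ.node ∧ f σ.node ≠ g σ.node}

lemma mem_DA {f g : Node N → Val C} {n : Node N} (h : f n ≠ g n) :
    (⟨n, f n, g n⟩ : Cmd N C) ∈ DA f g := ⟨rfl, rfl, h⟩

lemma eq_of_mem_DA {f g : Node N → Val C} {σ : Cmd N C} (h : σ ∈ DA f g) :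
    σ = ⟨σ.node, f σ.node, g σ.node⟩ := by
  obtain ⟨n, x, y⟩ := σ
  obtain ⟨h1, h2, -⟩ := h
  simp only at h1 h2
  subst h1 h2
  rfl

lemma anc_append (m n : Node N) (s : List N) (hs : s ≠ []) (h : n.1 = m.1 ++ s) : Anc m n := by
  refine ⟨⟨s, h.symm⟩, ?_⟩
  rintro rfl
  simp at h
  exact hs h

lemma exists_append {m n : Node N} (h : Anc m n) : ∃ s : List N, s ≠ [] ∧ n.1 = m.1 ++ s := by
  obtain ⟨⟨s, hs⟩, hne⟩ := h
  refine ⟨s, ?_, hs.symm⟩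
  rintro rfl
  simp at hs
  exact hne (Subtype.ext hs)

/-- Chain upwards. -/
lemma chain_up (f g : Node N → Val C) (hf : ValidFS f) (hg : ValidFS g) (m : Node N)
    (hm : f m = Val.dir) (hm2 : g m ≠ Val.dir) (s : List N) :
    ∀ n : Node N, n.1 = m.1 ++ s → f n ≠ Val.empty →
    Relation.ReflTransGen (fun a b => a ∈ DA f g ∧ b ∈ DA f g ∧ LL a b)
      ⟨n, f n, g n⟩ ⟨m, f m, g m⟩ := by
  induction s using List.reverseRecOn with
  | nil =>
    intro n hn _
    have : n = m := Subtype.ext (by simpa using hn)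
    subst this
    exact .refl
  | append_singleton s a ih =>
    intro n hn hfn
    have hgn : g n = Val.empty := by
      by_contra h
      exact hm2 (hg.2 n m (anc_append m n _ (by simp) hn) h)
    let p : Node N := ⟨m.1 ++ s, by simp [m.2]⟩
    have hpn : IsParent p n := ⟨a, by simp [hn, p]⟩
    have hfp : f p = Val.dir :=
      hf.2 n p (anc_append p n [a] (by simp) (by simp [hn, p])) hfn
    have hgp : g p ≠ Val.dir := by
      intro h
      by_cases hs : s = []
      · have : p = m := Subtype.ext (by simp [p, hs])
        exact hm2 (this ▸ h)
      · exact hm2 (hg.2 p m (anc_append m p s hs rfl) (by simp [h]))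
    refine .head ⟨mem_DA (by rw [hgn]; exact hfn), mem_DA (by rw [hfp]; exact hgp.symm), ?_⟩
      (ih p rfl (by simp [hfp]))
    exact Or.inl ⟨hpn, hgn, hfn, hfp, hgp⟩

/-- Chain downwards. -/
lemma chain_down (f g : Node N → Val C) (hf : ValidFS f) (hg : ValidFS g) (m : Node N)
    (hm : g m = Val.dir) (hm2 : f m ≠ Val.dir) (s : List N) :
    ∀ n : Node N, n.1 = m.1 ++ s → g n ≠ Val.empty →
    Relation.ReflTransGen (fun a b => a ∈ DA f g ∧ b ∈ DA f g ∧ LL a b)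
      ⟨m, f m, g m⟩ ⟨n, f n, g n⟩ := by
  induction s using List.reverseRecOn with
  | nil =>
    intro n hn _
    have : n = m := Subtype.ext (by simpa using hn)
    subst this
    exact .refl
  | append_singleton s a ih =>
    intro n hn hgn
    have hfn : f n = Val.empty := by
      by_contra h
      exact hm2 (hf.2 n m (anc_append m n _ (by simp) hn) h)
    let p : Node N := ⟨m.1 ++ s, by simp [m.2]⟩
    have hpn : IsParent p n := ⟨a, by simp [hn, p]⟩
    have hgp : g p = Val.dir :=
      hg.2 n p (anc_append p n [a] (by simp) (by simp [hn, p])) hgn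
    have hfp : f p ≠ Val.dir := by
      intro h
      by_cases hs : s = []
      · have : p = m := Subtype.ext (by simp [p, hs])
        exact hm2 (this ▸ h)
      · exact hm2 (hf.2 p m (anc_append m p s hs rfl) (by simp [h]))
    refine .tail (ih p rfl (by simp [hgp]))
      ⟨mem_DA (by rw [hgp]; exact hfp), mem_DA (by rw [hfn]; exact hgn.symm), ?_⟩
    exact Or.inr ⟨hpn, hgp, hfp, hfn, hgn⟩

lemma connected_aux (f g : Node N → Val C) (hf : ValidFS f) (hg : ValidFS g) (m n : Node N)
    (hmn : Anc m n) (hm : f m ≠ g m) (hn : f n ≠ g n) :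
    Relation.ReflTransGen (fun a b => a ∈ DA f g ∧ b ∈ DA f g ∧ LL a b)
      ⟨m, f m, g m⟩ ⟨n, f n, g n⟩ ∨
    Relation.ReflTransGen (fun a b => a ∈ DA f g ∧ b ∈ DA f g ∧ LL a b)
      ⟨n, f n, g n⟩ ⟨m, f m, g m⟩ := by
  obtain ⟨s, -, hs⟩ := exists_append hmn
  by_cases h : f n = Val.empty
  · have h2 : g n ≠ Val.empty := fun h' => hn (h.trans h'.symm)
    have h3 := hg.2 n m hmn h2
    exact Or.inl (chain_down f g hf hg m h3 (fun h' => hm (h'.trans h3.symm)) s n hs h2)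
  · have h3 := hf.2 n m hmn h
    exact Or.inr (chain_up f g hf hg m h3 (fun h' => hm (h3.trans h'.symm)) s n hs h)

lemma DA_finite (f g : Node N → Val C) (hf : ValidFS f) (hg : ValidFS g) : (DA f g).Finite := by
  refine ((hf.1.union hg.1).image (fun n => (⟨n, f n, g n⟩ : Cmd N C))).subset ?_
  intro σ hσ
  refine ⟨σ.node, ?_, (eq_of_mem_DA hσ).symm⟩
  by_contra h
  simp only [Set.mem_union, Set.mem_setOf_eq, not_or, not_not] at h
  exact hσ.2.2 (h.1.trans h.2.symm)

lemma DA_canonical (f g : Node N → Val C) (hf : ValidFS f) (hg : ValidFS g) :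
    Canonical (DA f g) := by
  refine ⟨DA_finite f g hf hg, ?_, ?_, ?_⟩
  · rintro σ ⟨h1, h2, h3⟩
    rw [h1, h2]; exact h3
  · intro σ hσ τ hτ h
    rw [eq_of_mem_DA hσ, eq_of_mem_DA hτ, h]
  · intro σ hσ τ hτ hne hc
    have e1 := eq_of_mem_DA hσ
    have e2 := eq_of_mem_DA hτ
    rw [e1, e2]
    rcases hc with hc | hc
    · exact connected_aux f g hf hg _ _ ⟨hc, hne⟩ hσ.2.2 hτ.2.2
    · exact (connected_aux f g hf hg _ _ ⟨hc, hne.symm⟩ hτ.2.2 hσ.2.2).symm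

open Classical in
/-- Sorting key. -/
noncomputable def key (σ : Cmd N C) : ℤ :=
  if σ.out = Val.empty then -(σ.node.1.length : ℤ)
  else if σ.inp = Val.empty then (σ.node.1.length : ℤ) else 0

lemma key_lt {σ τ : Cmd N C} (h : LL σ τ) : key σ < key τ := by
  rcases h with ⟨⟨a, ha⟩, h1, h2, h3, h4⟩ | ⟨⟨a, ha⟩, h1, h2, h3, h4⟩
  · have := congrArg List.length ha
    simp only [List.length_append, List.length_singleton] at this
    unfold key
    simp only [h1, h3, if_true]
    split_ifs <;> simp_all <;> omega
  · have := congrArg List.length ha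
    simp only [List.length_append, List.length_singleton] at this
    unfold key
    simp only [h1, h3, h4, if_true]
    split_ifs <;> simp_all <;> omega

lemma pair_sublist {α : Type} {l : List α} {a b : α} (ha : a ∈ l) (hb : b ∈ l) (hab : a ≠ b) :
    [a, b].Sublist l ∨ [b, a].Sublist l := by
  induction l with
  | nil => simp at ha
  | cons x l ih =>
    rcases List.mem_cons.1 ha with rfl | ha'
    · rcases List.mem_cons.1 hb with rfl | hb'
      · exact absurd rfl hab
      · exact Or.inl ((List.singleton_sublist.2 hb').cons_cons _)
    · rcases List.mem_cons.1 hb with rfl | hb'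
      · exact Or.inr ((List.singleton_sublist.2 ha').cons_cons _)
      · exact (ih ha' hb').imp (fun h => h.cons _) (fun h => h.cons _)

lemma pair_antisymm {α : Type} {l : List α} {a b : α} (hl : l.Nodup) (h1 : [a, b].Sublist l)
    (h2 : [b, a].Sublist l) : False := by
  induction l with
  | nil => simp at h1
  | cons x l ih =>
    rw [List.nodup_cons] at hl
    have hab : a ≠ b := by
      rintro rfl
      have := h1.nodup (List.nodup_cons.2 hl)
      simp at this
    rcases List.sublist_cons_iff.1 h1 with h1' | ⟨r, hr, h1'⟩
    · rcases List.sublist_cons_iff.1 h2 with h2' | ⟨r, hr, h2'⟩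
      · exact ih hl.2 h1' h2'
      · have : b ∈ l := h1'.subset (by simp)
        simp only [List.cons.injEq] at hr
        exact hl.1 (hr.1 ▸ this)
    · rcases List.sublist_cons_iff.1 h2 with h2' | ⟨r', hr', h2'⟩
      · have : a ∈ l := h2'.subset (by simp)
        simp only [List.cons.injEq] at hr
        exact hl.1 (hr.1 ▸ this)
      · simp only [List.cons.injEq] at hr hr'
        exact hab (hr.1.trans hr'.1.symm)

lemma exists_orders (A : Set (Cmd N C)) (hA : A.Finite) : ∃ α, Orders A α := by
  classical
  let le : Cmd N C → Cmd N C → Bool := fun a b => decide (key a ≤ key b)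
  have hp : (hA.toFinset.toList.mergeSort le).Perm hA.toFinset.toList := List.mergeSort_perm _ _
  have hs : (hA.toFinset.toList.mergeSort le).Pairwise (fun a b => le a b) := by
    apply List.pairwise_mergeSort
    · intro a b c h1 h2
      simp only [le, decide_eq_true_eq] at *
      exact h1.trans h2
    · intro a b
      simp only [le, Bool.or_eq_true, decide_eq_true_eq]
      exact le_total _ _
  refine ⟨hA.toFinset.toList.mergeSort le, ?_, ?_, ?_⟩
  · exact hp.nodup_iff.2 (Finset.nodup_toList _)
  · intro σ
    rw [hp.mem_iff]; simp
  · intro σ hσ τ hτ h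
    have hk := key_lt h
    have hne : σ ≠ τ := by rintro rfl; exact lt_irrefl _ hk
    rcases pair_sublist hσ hτ hne with h' | h'
    · exact h'
    · have := List.pairwise_iff_forall_sublist.1 hs h'
      simp only [le, decide_eq_true_eq] at this
      exact absurd hk (not_lt.2 this)

/-- A mixed filesystem along an LL-closed set of commands is valid. -/
lemma mixed_valid (f g h : Node N → Val C) (hf : ValidFS f) (hg : ValidFS g) (S : Set (Cmd N C))
    (hS : ∀ σ ∈ S, ∀ ρ ∈ DA f g, LL ρ σ → ρ ∈ S)
    (h1 : ∀ n, (⟨n, f n, g n⟩ : Cmd N C) ∈ S → h n = g n)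
    (h2 : ∀ n, (⟨n, f n, g n⟩ : Cmd N C) ∉ S → h n = f n) : ValidFS h := by
  have hcl : ∀ σ ρ, Relation.ReflTransGen (fun a b => a ∈ DA f g ∧ b ∈ DA f g ∧ LL a b) ρ σ →
      σ ∈ S → ρ ∈ S := by
    intro σ ρ hr hσ
    induction hr using Relation.ReflTransGen.head_induction_on with
    | refl => exact hσ
    | head hab _ ih => exact hS _ ih _ hab.1 hab.2.2
  refine ⟨(hf.1.union hg.1).subset ?_, ?_⟩
  · intro n hn
    by_cases hnS : (⟨n, f n, g n⟩ : Cmd N C) ∈ S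
    · right; simpa [h1 n hnS] using hn
    · left; simpa [h2 n hnS] using hn
  · intro n m hmn hn
    obtain ⟨s, -, hs⟩ := exists_append hmn
    by_cases hnS : (⟨n, f n, g n⟩ : Cmd N C) ∈ S
    · rw [h1 n hnS] at hn
      have hgm := hg.2 n m hmn hn
      by_cases hmS : (⟨m, f m, g m⟩ : Cmd N C) ∈ S
      · rw [h1 m hmS, hgm]
      · rw [h2 m hmS]
        by_contra hfm
        exact hmS (hcl _ _ (chain_down f g hf hg m hgm hfm s n hs hn) hnS)
    · rw [h2 n hnS] at hn
      have hfm := hf.2 n m hmn hn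
      by_cases hmS : (⟨m, f m, g m⟩ : Cmd N C) ∈ S
      · rw [h1 m hmS]
        by_contra hgm
        exact hnS (hcl _ _ (chain_up f g hf hg m hfm hgm s n hs hn) hmS)
      · rw [h2 m hmS, hfm]

lemma run_aux (f g : Node N → Val C) (hf : ValidFS f) (hg : ValidFS g) (γ : List (Cmd N C)) :
    ∀ (β : List (Cmd N C)) (h : Node N → Val C), Orders (DA f g) (β ++ γ) →
    (∀ n, (⟨n, f n, g n⟩ : Cmd N C) ∈ β → h n = g n) →
    (∀ n, (⟨n, f n, g n⟩ : Cmd N C) ∉ β → h n = f n) →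
    SeqOK γ h ∧ applySeq γ h = g := by
  induction γ with
  | nil =>
    intro β h ho h1 h2
    refine ⟨trivial, ?_⟩
    funext n
    change h n = g n
    by_cases hn : (⟨n, f n, g n⟩ : Cmd N C) ∈ β
    · exact h1 n hn
    · rw [h2 n hn]
      by_contra hne
      apply hn
      have := (ho.2.1 _).2 (mem_DA hne)
      simpa using this
  | cons σ γ ih =>
    intro β h ho h1 h2
    have hσ : σ ∈ DA f g := (ho.2.1 σ).1 (by simp)
    have e := eq_of_mem_DA hσ
    have hσβ : σ ∉ β := by
      intro hh
      have := (List.nodup_append.1 ho.1).2.2 σ hh σ (by simp)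
      exact this rfl
    have ho' : Orders (DA f g) ((β ++ [σ]) ++ γ) := by simpa using ho
    have h1' : ∀ n, (⟨n, f n, g n⟩ : Cmd N C) ∈ β ++ [σ] → upd h σ n = g n := by
      intro n hn
      unfold upd
      split_ifs with hh
      · rw [hσ.2.1, hh]
      · rcases List.mem_append.1 hn with hn | hn
        · exact h1 n hn
        · rw [List.mem_singleton] at hn
          exact absurd (congrArg Cmd.node hn) hh
    have h2' : ∀ n, (⟨n, f n, g n⟩ : Cmd N C) ∉ β ++ [σ] → upd h σ n = f n := by
      intro n hn
      rw [List.mem_append, not_or, List.mem_singleton] at hn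
      unfold upd
      split_ifs with hh
      · exact absurd (by rw [hh]; exact e.symm) hn.2
      · exact h2 n hn.1
    obtain ⟨i1, i2⟩ := ih (β ++ [σ]) (upd h σ) ho' h1' h2'
    refine ⟨⟨?_, ?_, i1⟩, i2⟩
    · rw [hσ.1]
      exact h2 _ (by rw [← e]; exact hσβ)
    · refine mixed_valid f g _ hf hg {τ | τ ∈ β ++ [σ]} ?_ h1' h2'
      intro τ hτ ρ hρ hl
      have hρm := (ho'.2.1 ρ).2 hρ
      rcases List.mem_append.1 hρm with hh | hh
      · exact hh
      · exfalso
        have s1 := ho'.2.2 ρ hρm τ (List.mem_append_left _ hτ) hl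
        have s2 : ([τ] ++ [ρ]).Sublist ((β ++ [σ]) ++ γ) :=
          (List.singleton_sublist.2 hτ).append (List.singleton_sublist.2 hh)
        exact pair_antisymm ho'.1 s1 s2

/-- The difference set `A = {⟨n, FS n, FS' n⟩ : FS n ≠ FS' n}` is canonical
and transforms `FS` into `FS'`. -/
theorem stmt_4 {N C : Type} [DecidableEq N] (f g : Node N → Val C)
    (hf : ValidFS f) (hg : ValidFS g) :
    Canonical {σ : Cmd N C | σ.inp = f σ.node ∧ σ.out = g σ.node ∧ f σ.node ≠ g σ.node} ∧
    SetApp {σ : Cmd N C | σ.inp = f σ.node ∧ σ.out = g σ.node ∧ f σ.node ≠ g σ.node} f g := by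
  refine ⟨DA_canonical f g hf hg, ⟨exists_orders _ (DA_finite f g hf hg), ?_⟩, ?_⟩
  · intro α hα
    exact (run_aux f g hf hg α [] f hα (by simp) (by simp)).1
  · intro α hα
    exact (run_aux f g hf hg α [] f hα (by simp) (by simp)).2

end FileSync
end

section
/- If the canonical command sets A and B are refluent, then A ∩ B is an initial segment of A; in particular the canonical set A is semantically equivalent to the composition (A ∩ B) ∘ (A ∖ B). -/
namespace FileSync

variable {N C : Type} [DecidableEq N]

theorem upd_self (f : Node N → Val C) (σ : Cmd N C) : upd f σ σ.node = σ.out := by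
  simp [upd]

theorem upd_ne (f : Node N → Val C) (σ : Cmd N C) {n : Node N} (h : n ≠ σ.node) :
    upd f σ n = f n := by
  simp [upd, h]

theorem app_not_mem (α : List (Cmd N C)) (f : Node N → Val C) (n : Node N)
    (h : ∀ σ ∈ α, σ.node ≠ n) : applySeq α f n = f n := by
  induction α generalizing f with
  | nil => rfl
  | cons a l ih =>
    have h1 := ih (upd f a) (fun σ hσ => h σ (List.mem_cons_of_mem _ hσ))
    have h2 : n ≠ a.node := fun e => h a List.mem_cons_self e.symm
    simp only [applySeq]
    rw [h1, upd_ne f a h2]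

theorem app_mem (α : List (Cmd N C)) (f : Node N → Val C) (σ : Cmd N C) (hσ : σ ∈ α)
    (hd : α.Nodup) (hu : ∀ σ ∈ α, ∀ τ ∈ α, σ.node = τ.node → σ = τ) :
    applySeq α f σ.node = σ.out := by
  induction α generalizing f with
  | nil => simp at hσ
  | cons a l ih =>
    simp only [applySeq]
    have hd' := List.nodup_cons.1 hd
    rcases List.mem_cons.1 hσ with e | hm
    · subst e
      rw [app_not_mem, upd_self]
      intro τ hτ e
      have := hu τ (List.mem_cons_of_mem _ hτ) σ List.mem_cons_self e
      exact hd'.1 (this ▸ hτ)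
    · exact ih (upd f a) hm hd'.2 (fun σ h1 τ h2 =>
        hu σ (List.mem_cons_of_mem _ h1) τ (List.mem_cons_of_mem _ h2))

theorem ok_inp (α : List (Cmd N C)) (f : Node N → Val C) (hok : SeqOK α f)
    (hd : α.Nodup) (hu : ∀ σ ∈ α, ∀ τ ∈ α, σ.node = τ.node → σ = τ)
    (σ : Cmd N C) (hσ : σ ∈ α) : f σ.node = σ.inp := by
  induction α generalizing f with
  | nil => simp at hσ
  | cons a l ih =>
    have hd' := List.nodup_cons.1 hd
    obtain ⟨h1, h2, h3⟩ := hok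
    rcases List.mem_cons.1 hσ with e | hm
    · subst e; exact h1
    · have h4 := ih (upd f a) h3 hd'.2 (fun σ h1 τ h2 =>
        hu σ (List.mem_cons_of_mem _ h1) τ (List.mem_cons_of_mem _ h2)) hm
      rw [upd_ne] at h4
      · exact h4
      · intro e
        have := hu σ hσ a List.mem_cons_self e
        exact hd'.1 (this ▸ hm)

theorem ok_valid (α : List (Cmd N C)) (f : Node N → Val C) (hf : ValidFS f)
    (hok : SeqOK α f) : ValidFS (applySeq α f) := by
  induction α generalizing f with
  | nil => exact hf
  | cons a l ih => exact ih _ hok.2.1 hok.2.2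

theorem ok_of_prefix (α : List (Cmd N C)) (f : Node N → Val C)
    (hd : α.Nodup) (hu : ∀ σ ∈ α, ∀ τ ∈ α, σ.node = τ.node → σ = τ)
    (hi : ∀ σ ∈ α, f σ.node = σ.inp)
    (hv : ∀ l₁ l₂, α = l₁ ++ l₂ → ValidFS (applySeq l₁ f)) : SeqOK α f := by
  induction α generalizing f with
  | nil => trivial
  | cons a l ih =>
    have hd' := List.nodup_cons.1 hd
    refine ⟨hi a List.mem_cons_self, hv [a] l rfl, ih _ hd'.2 (fun σ h1 τ h2 =>
        hu σ (List.mem_cons_of_mem _ h1) τ (List.mem_cons_of_mem _ h2)) ?_ ?_⟩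
    · intro σ hσ
      rw [upd_ne]
      · exact hi σ (List.mem_cons_of_mem _ hσ)
      · intro e
        have := hu σ (List.mem_cons_of_mem _ hσ) a List.mem_cons_self e
        exact hd'.1 (this ▸ hσ)
    · intro l₁ l₂ e
      exact hv (a :: l₁) l₂ (by rw [e]; rfl)

theorem isParent_prefix {p n : Node N} (h : IsParent p n) : p.1 <+: n.1 := by
  obtain ⟨a, e⟩ := h
  exact ⟨[a], e.symm⟩

theorem isParent_anc {p n : Node N} (h : IsParent p n) : Anc p n := by
  refine ⟨isParent_prefix h, ?_⟩
  rintro rfl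
  obtain ⟨a, e⟩ := h
  have := congrArg List.length e
  simp at this

/-- A chain starting at a command destroying a directory only moves up. -/
theorem chain_up_s8 (A : Set (Cmd N C)) (σ τ : Cmd N C)
    (h : Relation.ReflTransGen (fun a b => a ∈ A ∧ b ∈ A ∧ LL a b) σ τ)
    (h2 : σ.out ≠ Val.dir) (h1 : σ.inp = Val.dir) :
    τ.node.1 <+: σ.node.1 ∧ τ.out ≠ Val.dir ∧ τ.inp = Val.dir := by
  induction h with
  | refl => exact ⟨List.prefix_rfl, h2, h1⟩
  | tail _ hbc ih =>
    rcases hbc.2.2 with ⟨hp, _, _, hi, ho⟩ | ⟨_, ho, _⟩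
    · exact ⟨(isParent_prefix hp).trans ih.1, ho, hi⟩
    · exact absurd ho ih.2.1

/-- A chain ending at a command creating a directory only moves down. -/
theorem chain_down_s8 (A : Set (Cmd N C)) (σ τ : Cmd N C)
    (h : Relation.ReflTransGen (fun a b => a ∈ A ∧ b ∈ A ∧ LL a b) σ τ)
    (h2 : τ.out = Val.dir) (h1 : τ.inp ≠ Val.dir) :
    σ.node.1 <+: τ.node.1 ∧ σ.out = Val.dir ∧ σ.inp ≠ Val.dir := by
  induction h using Relation.ReflTransGen.head_induction_on with
  | refl => exact ⟨List.prefix_rfl, h2, h1⟩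
  | head hbc _ ih =>
    rcases hbc.2.2 with ⟨_, _, _, hi, _⟩ | ⟨hp, ho, hi, _⟩
    · exact absurd hi ih.2.2
    · exact ⟨(isParent_prefix hp).trans ih.1, ho, hi⟩

theorem honors_step (l₁ l₂ : List (Cmd N C)) (hd : (l₁ ++ l₂).Nodup) (σ τ : Cmd N C)
    (hs : List.Sublist [σ, τ] (l₁ ++ l₂)) (hτ : τ ∈ l₁) : σ ∈ l₁ := by
  obtain ⟨k₁, k₂, e, s1, s2⟩ := List.sublist_append_iff.1 hs
  cases k₁ with
  | nil =>
    simp only [List.nil_append] at e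
    subst e
    exact absurd (s2.subset (by simp)) (List.disjoint_of_nodup_append hd hτ)
  | cons a k =>
    simp only [List.cons_append, List.cons.injEq] at e
    rw [e.1]
    exact s1.subset (by simp)

theorem chain_mem (A : Set (Cmd N C)) (l₁ l₂ : List (Cmd N C)) (hO : Orders A (l₁ ++ l₂))
    (σ τ : Cmd N C)
    (h : Relation.ReflTransGen (fun a b => a ∈ A ∧ b ∈ A ∧ LL a b) σ τ) (hτ : τ ∈ l₁) :
    σ ∈ l₁ := by
  induction h using Relation.ReflTransGen.head_induction_on with
  | refl => exact hτ
  | head hbc _ ih =>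
    exact honors_step l₁ l₂ hO.1 _ _
      (hO.2.2 _ ((hO.2.1 _).2 hbc.1) _ ((hO.2.1 _).2 hbc.2.1) hbc.2.2) ih

theorem orders_uniq {A : Set (Cmd N C)} (hA : Canonical A) {α : List (Cmd N C)}
    (hO : Orders A α) : ∀ σ ∈ α, ∀ τ ∈ α, σ.node = τ.node → σ = τ :=
  fun σ h1 τ h2 => hA.2.2.1 σ ((hO.2.1 σ).1 h1) τ ((hO.2.1 τ).1 h2)

/-- Intermediate filesystems are valid once the initial and final ones are. -/
theorem prefix_valid (A : Set (Cmd N C)) (hA : Canonical A) (l₁ l₂ : List (Cmd N C))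
    (hO : Orders A (l₁ ++ l₂)) (f : Node N → Val C) (hf : ValidFS f)
    (hi : ∀ σ ∈ A, f σ.node = σ.inp) (hg : ValidFS (applySeq (l₁ ++ l₂) f)) :
    ValidFS (applySeq l₁ f) := by
  have hu := orders_uniq hA hO
  set g := applySeq (l₁ ++ l₂) f with hgd
  have gm : ∀ σ ∈ A, g σ.node = σ.out := fun σ hσ =>
    app_mem _ f σ ((hO.2.1 σ).2 hσ) hO.1 hu
  have gn : ∀ n, (∀ σ ∈ A, σ.node ≠ n) → g n = f n := fun n hn =>
    app_not_mem _ f n (fun σ hσ => hn σ ((hO.2.1 σ).1 hσ))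
  have mA : ∀ σ ∈ l₁, σ ∈ A := fun σ hσ => (hO.2.1 σ).1 (List.mem_append_left _ hσ)
  have hm : ∀ σ ∈ l₁, applySeq l₁ f σ.node = g σ.node := by
    intro σ hσ
    rw [gm σ (mA σ hσ)]
    exact app_mem _ f σ hσ (List.nodup_append.1 hO.1).1 (fun σ h1 τ h2 =>
      hu σ (List.mem_append_left _ h1) τ (List.mem_append_left _ h2))
  -- each node either carries an applied command, or has its old value
  have hcase : ∀ n, (∃ σ ∈ l₁, σ.node = n ∧ applySeq l₁ f n = g n) ∨
      ((∀ σ ∈ l₁, σ.node ≠ n) ∧ applySeq l₁ f n = f n) := by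
    intro n
    by_cases h : ∃ σ ∈ l₁, σ.node = n
    · obtain ⟨σ, hσ, rfl⟩ := h
      exact Or.inl ⟨σ, hσ, rfl, hm σ hσ⟩
    · push Not at h
      exact Or.inr ⟨h, app_not_mem _ f n h⟩
  refine ⟨(hf.1.union hg.1).subset ?_, ?_⟩
  · intro n hn
    rcases hcase n with ⟨_, _, _, e⟩ | ⟨_, e⟩
    · right; simpa [e] using hn
    · left; simpa [e] using hn
  · intro n m hmn hn
    have hnm : ¬ n.1 <+: m.1 := fun hp =>
      hmn.2 (Subtype.ext (hmn.1.eq_of_length_le hp.length_le))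
    rcases hcase n with ⟨σ, hσ, en, e⟩ | ⟨hn', e⟩ <;>
      rcases hcase m with ⟨τ, hτ, em, e'⟩ | ⟨hm', e'⟩
    · rw [e']; exact hg.2 n m hmn (e ▸ hn)
    · rw [e']
      by_contra hD
      have hgD : g m = Val.dir := hg.2 n m hmn (e ▸ hn)
      obtain ⟨τ, hτ, em⟩ : ∃ τ ∈ A, τ.node = m := by
        by_contra hh
        push Not at hh
        exact hD ((gn m hh) ▸ hgD)
      subst em; subst en
      have hτi : τ.inp ≠ Val.dir := hi τ hτ ▸ hD
      have hτo : τ.out = Val.dir := gm τ hτ ▸ hgD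
      rcases hA.2.2.2 τ hτ σ (mA σ hσ) hmn.2 (Or.inl hmn.1) with hc | hc
      · exact hm' τ (chain_mem A l₁ l₂ hO τ σ hc hσ) rfl
      · exact hnm (chain_down_s8 A σ τ hc hτo hτi).1
    · rw [e']
      by_contra hD
      have hfD : f m = Val.dir := hf.2 n m hmn (e ▸ hn)
      have hgE : g n = Val.empty := by
        by_contra hE
        exact hD (hg.2 n m hmn hE)
      obtain ⟨σ, hσ, en⟩ : ∃ σ ∈ A, σ.node = n := by
        by_contra hh
        push Not at hh
        rw [gn n hh, ← e] at hgE
        exact hn hgE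
      subst em; subst en
      have hτA := mA τ hτ
      have hτi : τ.inp = Val.dir := hi τ hτA ▸ hfD
      have hτo : τ.out ≠ Val.dir := gm τ hτA ▸ hD
      rcases hA.2.2.2 τ hτA σ hσ hmn.2 (Or.inl hmn.1) with hc | hc
      · exact hnm (chain_up_s8 A τ σ hc hτo hτi).1
      · exact hn' σ (chain_mem A l₁ l₂ hO σ τ hc hτ) rfl
    · rw [e']; exact hf.2 n m hmn (e ▸ hn)

theorem orders_app_eq (A : Set (Cmd N C)) (hA : Canonical A) (α β : List (Cmd N C))
    (hα : Orders A α) (hβ : Orders A β) (f : Node N → Val C) :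
    applySeq α f = applySeq β f := by
  funext n
  by_cases h : ∃ σ ∈ A, σ.node = n
  · obtain ⟨σ, hσ, rfl⟩ := h
    rw [app_mem α f σ ((hα.2.1 σ).2 hσ) hα.1 (orders_uniq hA hα),
      app_mem β f σ ((hβ.2.1 σ).2 hσ) hβ.1 (orders_uniq hA hβ)]
  · push Not at h
    rw [app_not_mem α f n (fun σ hσ => h σ ((hα.2.1 σ).1 hσ)),
      app_not_mem β f n (fun σ hσ => h σ ((hβ.2.1 σ).1 hσ))]

theorem orders_ok (A : Set (Cmd N C)) (hA : Canonical A) (α β : List (Cmd N C))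
    (hα : Orders A α) (hβ : Orders A β) (f : Node N → Val C) (hf : ValidFS f)
    (hok : SeqOK α f) : SeqOK β f := by
  have hi : ∀ σ ∈ A, f σ.node = σ.inp := fun σ hσ =>
    ok_inp α f hok hα.1 (orders_uniq hA hα) σ ((hα.2.1 σ).2 hσ)
  have hv := ok_valid α f hf hok
  rw [orders_app_eq A hA α β hα hβ f] at hv
  refine ok_of_prefix β f hβ.1 (orders_uniq hA hβ) (fun σ hσ => hi σ ((hβ.2.1 σ).1 hσ)) ?_
  rintro l₁ l₂ rfl
  exact prefix_valid A hA l₁ l₂ hβ f hf hi hv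

/-- The intersection of refluent canonical sets is downward closed in each. -/
theorem inter_down (A B : Set (Cmd N C)) (hA : Canonical A) (hB : Canonical B)
    (h : Refluent A B) (σ τ : Cmd N C) (hσ : σ ∈ A) (hτ : τ ∈ A) (hτB : τ ∈ B)
    (hl : LL σ τ) : σ ∈ B := by
  obtain ⟨f, hf, ⟨⟨α, hα⟩, hα'⟩, ⟨⟨β, hβ⟩, hβ'⟩⟩ := h
  have hfσ : f σ.node = σ.inp :=
    ok_inp α f (hα' α hα) hα.1 (orders_uniq hA hα) σ ((hα.2.1 σ).2 hσ)
  have hv := ok_valid β f hf (hβ' β hβ)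
  have bm : ∀ ρ ∈ B, applySeq β f ρ.node = ρ.out := fun ρ hρ =>
    app_mem β f ρ ((hβ.2.1 ρ).2 hρ) hβ.1 (orders_uniq hB hβ)
  have bi : ∀ ρ ∈ B, f ρ.node = ρ.inp := fun ρ hρ =>
    ok_inp β f (hβ' β hβ) hβ.1 (orders_uniq hB hβ) ρ ((hβ.2.1 ρ).2 hρ)
  have hout : applySeq β f σ.node = σ.out := by
    rcases hl with ⟨hp, ho, hi, ti, hto⟩ | ⟨hp, ho, hi, ti, hto⟩
    · rw [ho]
      by_contra hE
      exact hto (bm τ hτB ▸ hv.2 _ _ (isParent_anc hp) hE)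
    · rw [ho]
      exact hv.2 _ _ (isParent_anc hp) (by rw [bm τ hτB]; exact hto)
  by_cases hh : ∃ ρ ∈ B, ρ.node = σ.node
  · obtain ⟨ρ, hρ, e⟩ := hh
    have e1 : ρ.inp = σ.inp := by rw [← bi ρ hρ, e, hfσ]
    have e2 : ρ.out = σ.out := by rw [← bm ρ hρ, e, hout]
    have : ρ = σ := by
      cases ρ; cases σ; simp_all
    exact this ▸ hρ
  · push Not at hh
    rw [app_not_mem β f _ (fun ρ hρ => hh ρ ((hβ.2.1 ρ).1 hρ)), hfσ] at hout
    exact absurd hout (hA.2.1 σ hσ)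

theorem orders_append (A B : Set (Cmd N C)) (hA : Canonical A) (hB : Canonical B)
    (h : Refluent A B) (α₁ α₂ : List (Cmd N C)) (h1 : Orders (A ∩ B) α₁)
    (h2 : Orders (A \ B) α₂) : Orders A (α₁ ++ α₂) := by
  refine ⟨List.nodup_append'.2 ⟨h1.1, h2.1, ?_⟩, ?_, ?_⟩
  · intro σ a b
    exact ((h2.2.1 σ).1 b).2 ((h1.2.1 σ).1 a).2
  · intro σ
    rw [List.mem_append, h1.2.1, h2.2.1]
    by_cases hb : σ ∈ B <;> simp [hb]
  · intro σ hσ τ hτ hl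
    rcases List.mem_append.1 hσ with a | a <;> rcases List.mem_append.1 hτ with b | b
    · exact (h1.2.2 σ a τ b hl).trans (List.sublist_append_left _ _)
    · exact List.Sublist.append (List.singleton_sublist.2 a) (List.singleton_sublist.2 b)
    · have a' := (h2.2.1 σ).1 a
      have b' := (h1.2.1 τ).1 b
      exact absurd (inter_down A B hA hB h σ τ a'.1 b'.1 b'.2 hl) a'.2
    · exact (h2.2.2 σ a τ b hl).trans (List.sublist_append_right _ _)

open Classical in
theorem orders_filter (A S : Set (Cmd N C)) (α : List (Cmd N C)) (hα : Orders A α)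
    (hS : S ⊆ A) : Orders S (α.filter (fun σ => decide (σ ∈ S))) := by
  refine ⟨hα.1.filter _, ?_, ?_⟩
  · intro σ
    simp only [List.mem_filter, decide_eq_true_eq, hα.2.1]
    exact ⟨fun x => x.2, fun x => ⟨hS x, x⟩⟩
  · intro σ hσ τ hτ hl
    rw [List.mem_filter] at hσ hτ
    have := (hα.2.2 σ hσ.1 τ hτ.1 hl).filter (fun σ => decide (σ ∈ S))
    have hs := of_decide_eq_true hσ.2
    have ht := of_decide_eq_true hτ.2
    simpa [List.filter_cons, hs, ht] using this

/-- If canonical sets `A`, `B` are refluent, then `A ∩ B` is an initial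
segment of `A`; in particular `A ≡ (A ∩ B) ∘ (A \ B)`. -/
theorem stmt_8 {N C : Type} [DecidableEq N] (A B : Set (Cmd N C))
    (hA : Canonical A) (hB : Canonical B) (h : Refluent A B) :
    InitSeg (A ∩ B) A ∧
    ∀ α α₁ α₂ : List (Cmd N C), Orders A α → Orders (A ∩ B) α₁ → Orders (A \ B) α₂ →
      SeqEquiv α (α₁ ++ α₂) := by
  constructor
  · obtain ⟨f, hf, ⟨⟨α, hα⟩, hα'⟩, hb⟩ := id h
    have h1 := orders_filter A (A ∩ B) α hα Set.inter_subset_left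
    have h2 := orders_filter A (A \ B) α hα Set.sdiff_subset
    refine ⟨Set.inter_subset_left, _, _, h1, ?_, orders_append A B hA hB h _ _ h1 h2⟩
    rwa [Set.sdiff_self_inter]
  · intro α α₁ α₂ hα h1 h2 f hf
    have h3 := orders_append A B hA hB h α₁ α₂ h1 h2
    exact ⟨⟨orders_ok A hA _ _ hα h3 f hf, orders_ok A hA _ _ h3 hα f hf⟩,
      fun _ => orders_app_eq A hA _ _ hα h3 f⟩

end FileSync
end
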